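/- arXiv:1301.0973 — 2 statements merged into one kernel-verified Lean document; each statement's English description precedes it below -/
import Mathlib

section
/- Let n ≥ 4 and let k be an integer with 2 ≤ k ≤ n−2. Let A be a signed graph on n vertices whose underlying graph is connected. Then the exterior k-th power ∧^k A is balanced if and only if either (i) the underlying graph of A is a path, or (ii) the underlying graph of A is a cycle and (A is balanced if and only if k is odd). -/
open Matrix Finset

def IsSignedMatrix {ι : Type*} (B : Matrix ι ι ℝ) : Prop :=
  B.IsSymm ∧ (∀ i, B i i = 0) ∧ ∀ i j, B i j = -1 ∨ B i j = 0 ∨ B i j = 1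

def IsBalancedMatrix {ι : Type*} [Fintype ι] (B : Matrix ι ι ℝ) : Prop :=
  ∃ D : Matrix ι ι ℝ, D.IsDiag ∧ (∀ i, D i i = 1 ∨ D i i = -1) ∧
    D * B * D = Matrix.of fun i j => |B i j|

def cartPow {n : ℕ} (A : Matrix (Fin n) (Fin n) ℝ) (k : ℕ) :
    Matrix (Fin k → Fin n) (Fin k → Fin n) ℝ :=
  Matrix.of fun u v => ∑ i : Fin k, A (u i) (v i) *
    ∏ j ∈ Finset.univ.erase i, (if u j = v j then (1 : ℝ) else 0)

noncomputable def enumOf {n k : ℕ} (r : LinearOrder (Fin n)) (S : Finset (Fin n))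
    (h : S.card = k) : Fin k → Fin n :=
  fun i => ((@Finset.orderIsoOfFin (Fin n) r S k h) i : Fin n)

noncomputable def altOf {n : ℕ} (k : ℕ) (r : LinearOrder (Fin n)) :
    Matrix (Fin k → Fin n) {S : Finset (Fin n) // S.card = k} ℝ :=
  Matrix.of fun u S =>
    (Real.sqrt (Nat.factorial k))⁻¹ *
      ∑ π : Equiv.Perm (Fin k),
        if u = enumOf r S.1 S.2 ∘ π then ((Equiv.Perm.sign π : ℤ) : ℝ) else 0

noncomputable def alt (n k : ℕ) :
    Matrix (Fin k → Fin n) {S : Finset (Fin n) // S.card = k} ℝ :=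
  altOf k inferInstance

noncomputable def extPow {n : ℕ} (A : Matrix (Fin n) (Fin n) ℝ) (k : ℕ) :
    Matrix {S : Finset (Fin n) // S.card = k} {S : Finset (Fin n) // S.card = k} ℝ :=
  (alt n k)ᵀ * cartPow A k * alt n k

def IsPathMatrix {n : ℕ} (A : Matrix (Fin n) (Fin n) ℝ) : Prop :=
  ∃ g : Equiv.Perm (Fin n), ∀ i j : Fin n,
    |A (g i) (g j)| = 1 ↔ ((i : ℤ) - j = 1 ∨ (j : ℤ) - i = 1)

def IsCycleMatrix {n : ℕ} (A : Matrix (Fin n) (Fin n) ℝ) : Prop :=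
  3 ≤ n ∧ ∃ g : Equiv.Perm (Fin n), ∀ i j : Fin n,
    |A (g i) (g j)| = 1 ↔
      ((i : ℤ) - j ≡ 1 [ZMOD (n : ℤ)] ∨ (i : ℤ) - j ≡ -1 [ZMOD (n : ℤ)])

def signedAdjGraph {n : ℕ} (A : Matrix (Fin n) (Fin n) ℝ) : SimpleGraph (Fin n) :=
  SimpleGraph.fromRel (fun u v => |A u v| = 1)

/-- The sign of the linear ordering of the entries of `w`. -/
noncomputable def orderSign {k : ℕ} (w : Fin k → ℕ) : ℝ :=
  ∏ i, ∏ j ∈ Finset.Ioi i, if w i < w j then 1 else -1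

theorem orderSign_strictMono {k : ℕ} {w : Fin k → ℕ} (hw : StrictMono w) : orderSign w = 1 := by
  refine Finset.prod_eq_one fun i _ => Finset.prod_eq_one fun j hj => ?_
  rw [if_pos (hw (Finset.mem_Ioi.1 hj))]

theorem orderSign_eq_sign_det {k : ℕ} {w : Fin k → ℕ} (hw : Function.Injective w) :
    orderSign w =
      ((SignType.sign (Matrix.vandermonde fun i => (w i : ℤ)).det : SignType) : ℝ) := by
  have coe_prod : ∀ (s : Finset (Fin k)) (g : Fin k → SignType),
      ((∏ i ∈ s, g i : SignType) : ℝ) = ∏ i ∈ s, (g i : ℝ) := fun s g =>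
    map_prod (SignType.castHom : SignType →*₀ ℝ) g s
  rw [Matrix.det_vandermonde, ← signHom_apply, map_prod, coe_prod]
  refine Finset.prod_congr rfl fun i _ => ?_
  rw [map_prod, coe_prod]
  refine Finset.prod_congr rfl fun j hj => ?_
  have hne : w i ≠ w j := fun h => (Finset.mem_Ioi.1 hj).ne (hw h)
  rw [signHom_apply]
  split_ifs with h
  · rw [sign_pos (by omega)]; simp
  · rw [sign_neg (by omega)]; simp

theorem orderSign_comp {k : ℕ} {w : Fin k → ℕ} (hw : Function.Injective w)
    (π : Equiv.Perm (Fin k)) :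
    orderSign (w ∘ π) = ((Equiv.Perm.sign π : ℤ) : ℝ) * orderSign w := by
  rw [orderSign_eq_sign_det hw, orderSign_eq_sign_det (hw.comp π.injective)]
  have : (Matrix.vandermonde fun i => (((w ∘ π) i : ℕ) : ℤ)) =
      (Matrix.vandermonde fun i => (w i : ℤ)).submatrix π id := by
    ext i j; simp [Matrix.vandermonde]
  rw [this, Matrix.det_permute, sign_mul]
  rcases Int.units_eq_one_or (Equiv.Perm.sign π) with h | h <;> simp [h]

theorem orderSign_eq_or {k : ℕ} (w : Fin k → ℕ) : orderSign w = 1 ∨ orderSign w = -1 := by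
  refine Finset.prod_induction _ (fun x : ℝ => x = 1 ∨ x = -1) ?_ (Or.inl rfl) fun i _ =>
    Finset.prod_induction _ (fun x : ℝ => x = 1 ∨ x = -1) ?_ (Or.inl rfl) fun j _ => ?_
  · rintro a b (rfl | rfl) (rfl | rfl) <;> simp
  · rintro a b (rfl | rfl) (rfl | rfl) <;> simp
  · split_ifs <;> simp

/-- If moving the `a`-th entry of `w` to `x` multiplies all its comparisons with the other entries
by `ε`, then the order sign changes by `ε ^ (k - 1)`. -/
theorem orderSign_mul_update {k : ℕ} (w : Fin k → ℕ) (a : Fin k) (x : ℕ) (ε : ℝ)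
    (h : ∀ j, j ≠ a → (if w a < w j then (1 : ℝ) else -1) * (if x < w j then 1 else -1) = ε)
    (h' : ∀ j, j ≠ a → (if w j < w a then (1 : ℝ) else -1) * (if w j < x then 1 else -1) = ε) :
    orderSign w * orderSign (Function.update w a x) = ε ^ (k - 1) := by
  unfold orderSign
  rw [← Finset.prod_mul_distrib]
  simp only [← Finset.prod_mul_distrib]
  have key : ∀ i, ∏ j ∈ Finset.Ioi i, ((if w i < w j then (1 : ℝ) else -1) *
      (if Function.update w a x i < Function.update w a x j then 1 else -1)) =
      if i = a then ε ^ (k - 1 - a.1) else if i < a then ε else 1 := by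
    intro i
    split_ifs with h1 h2
    · subst h1
      rw [Finset.prod_congr rfl (g := fun _ => ε), Finset.prod_const, Fin.card_Ioi]
      intro j hj
      have := (Finset.mem_Ioi.1 hj).ne'
      simp only [Function.update_self, Function.update_of_ne this]
      exact h j this
    · rw [Finset.prod_eq_single_of_mem a (Finset.mem_Ioi.2 h2)]
      · simp only [Function.update_self, Function.update_of_ne h1]
        exact h' i h1
      · intro j _ hj
        simp only [Function.update_of_ne hj, Function.update_of_ne h1]
        split_ifs <;> simp
    · refine Finset.prod_eq_one fun j hj => ?_
      have : j ≠ a := by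
        rintro rfl
        exact h2 (Finset.mem_Ioi.1 hj)
      simp only [Function.update_of_ne this, Function.update_of_ne h1]
      split_ifs <;> simp
  rw [Finset.prod_congr rfl fun i _ => key i, ← Finset.mul_prod_erase _ _ (Finset.mem_univ a),
    if_pos rfl, Finset.prod_congr rfl (g := fun i => if i < a then ε else 1)
      fun i hi => if_neg (Finset.ne_of_mem_erase hi), Finset.prod_ite]
  have : (Finset.univ.erase a).filter (fun i => i < a) = Finset.Iio a := by
    ext i
    simp only [Finset.mem_filter, Finset.mem_erase, Finset.mem_univ, and_true, Finset.mem_Iio]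
    exact ⟨fun h => h.2, fun h => ⟨h.ne, h⟩⟩
  rw [this, Finset.prod_const, Finset.prod_const_one, mul_one, Fin.card_Iio, ← pow_add]
  congr 1
  omega

theorem isBalancedMatrix_iff {ι : Type*} [Fintype ι] {B : Matrix ι ι ℝ}
    (hB : ∀ i j, B i j = -1 ∨ B i j = 0 ∨ B i j = 1) :
    IsBalancedMatrix B ↔ ∃ d : ι → ℝ, (∀ i, d i = 1 ∨ d i = -1) ∧
      ∀ i j, B i j ≠ 0 → B i j = d i * d j := by
  classical
  have entry : ∀ (d : ι → ℝ) i j,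
      (Matrix.diagonal d * B * Matrix.diagonal d) i j = d i * B i j * d j := by
    intro d i j
    rw [Matrix.mul_diagonal, Matrix.diagonal_mul]
  constructor
  · rintro ⟨D, hD, h1, h2⟩
    refine ⟨fun i => D i i, h1, fun i j hij => ?_⟩
    have hdiag : Matrix.diagonal (fun i => D i i) = D := hD.diagonal_diag
    have h3 := congrFun (congrFun h2 i) j
    rw [← hdiag, entry, Matrix.of_apply] at h3
    rcases hB i j with h | h | h <;> rcases h1 i with h4 | h4 <;> rcases h1 j with h5 | h5 <;>
      simp only [h, h4, h5] at h3 hij ⊢ <;> norm_num at *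
  · rintro ⟨d, h1, h2⟩
    refine ⟨Matrix.diagonal d, Matrix.isDiag_diagonal d, by simpa using h1, ?_⟩
    ext i j
    rw [entry, Matrix.of_apply]
    by_cases hij : B i j = 0
    · simp [hij]
    · rw [h2 i j hij]
      rcases h1 i with h4 | h4 <;> rcases h1 j with h5 | h5 <;> simp [h4, h5]

/-- An alternating sign function on injective tuples whose change along every move of one entry
across an edge of `A` is the sign of that edge. -/
structure IsAltPotential {n k : ℕ} (A : Matrix (Fin n) (Fin n) ℝ)
    (f : (Fin k → Fin n) → ℝ) : Prop where
  eq_or : ∀ u, Function.Injective u → f u = 1 ∨ f u = -1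
  comp_perm : ∀ u (π : Equiv.Perm (Fin k)), Function.Injective u →
    f (u ∘ π) = ((Equiv.Perm.sign π : ℤ) : ℝ) * f u
  move : ∀ u i x, Function.Injective u → Function.Injective (Function.update u i x) →
    A (u i) x ≠ 0 → A (u i) x = f u * f (Function.update u i x)

theorem enumOf_strictMono {n k : ℕ} (S : Finset (Fin n)) (h : S.card = k) :
    StrictMono (enumOf inferInstance S h) := fun _ _ hij =>
  (S.orderIsoOfFin h).strictMono hij

theorem range_enumOf {n k : ℕ} (S : Finset (Fin n)) (h : S.card = k) :
    Set.range (enumOf inferInstance S h) = S := by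
  ext x
  constructor
  · rintro ⟨i, rfl⟩
    exact (S.orderIsoOfFin h i).2
  · intro hx
    exact ⟨(S.orderIsoOfFin h).symm ⟨x, hx⟩, by simp [enumOf]⟩

theorem exists_eq_comp_perm {ι α : Type*} [Finite ι] {u v : ι → α}
    (hu : Function.Injective u) (hv : Function.Injective v)
    (h : Set.range u = Set.range v) : ∃ π : Equiv.Perm ι, u = v ∘ π := by
  refine ⟨((Equiv.ofInjective u hu).trans (Equiv.setCongr h)).trans
    (Equiv.ofInjective v hv).symm, ?_⟩
  ext i
  simp [Equiv.apply_ofInjective_symm]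

theorem card_image_of_tuple_injective {n k : ℕ} {u : Fin k → Fin n}
    (hu : Function.Injective u) : (Finset.univ.image u).card = k := by
  rw [Finset.card_image_of_injective _ hu, Finset.card_fin]

theorem exists_eq_enumOf_comp {n k : ℕ} {u : Fin k → Fin n} (hu : Function.Injective u) :
    ∃ π : Equiv.Perm (Fin k), u = enumOf inferInstance (Finset.univ.image u)
      (card_image_of_tuple_injective hu) ∘ π :=
  exists_eq_comp_perm hu (enumOf_strictMono _ _).injective (by rw [range_enumOf]; simp)

theorem cartPow_comp {n k : ℕ} (A : Matrix (Fin n) (Fin n) ℝ) (u v : Fin k → Fin n)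
    (π : Equiv.Perm (Fin k)) : cartPow A k (u ∘ π) (v ∘ π) = cartPow A k u v := by
  simp only [cartPow, Matrix.of_apply, Function.comp_apply]
  refine Fintype.sum_equiv π _ _ fun i => congrArg _ ?_
  exact Finset.prod_equiv π (by simp) fun _ _ => rfl

/-- The antisymmetrization of `cartPow`. -/
noncomputable def altCartPow {n k : ℕ} (A : Matrix (Fin n) (Fin n) ℝ) (u v : Fin k → Fin n) : ℝ :=
  ∑ σ : Equiv.Perm (Fin k), ((Equiv.Perm.sign σ : ℤ) : ℝ) * cartPow A k u (v ∘ σ)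

theorem sign_mul_self_real {k : ℕ} (π : Equiv.Perm (Fin k)) :
    ((Equiv.Perm.sign π : ℤ) : ℝ) * ((Equiv.Perm.sign π : ℤ) : ℝ) = 1 := by
  rcases Int.units_eq_one_or (Equiv.Perm.sign π) with h | h <;> simp [h]

theorem altCartPow_comp_right {n k : ℕ} (A : Matrix (Fin n) (Fin n) ℝ) (u v : Fin k → Fin n)
    (τ : Equiv.Perm (Fin k)) :
    altCartPow A u (v ∘ τ) = ((Equiv.Perm.sign τ : ℤ) : ℝ) * altCartPow A u v := by
  unfold altCartPow
  rw [Finset.mul_sum, ← Equiv.sum_comp (Equiv.mulLeft τ)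
    (fun σ => ((Equiv.Perm.sign τ : ℤ) : ℝ) *
      (((Equiv.Perm.sign σ : ℤ) : ℝ) * cartPow A k u (v ∘ σ)))]
  refine Finset.sum_congr rfl fun σ _ => ?_
  have := sign_mul_self_real τ
  simp only [Equiv.coe_mulLeft, Equiv.Perm.sign_mul, Units.val_mul, Int.cast_mul,
    Equiv.Perm.coe_mul, Function.comp_assoc]
  linear_combination (-((Equiv.Perm.sign σ : ℤ) : ℝ) * cartPow A k u (v ∘ τ ∘ σ)) * this

theorem altCartPow_comp_left {n k : ℕ} (A : Matrix (Fin n) (Fin n) ℝ) (u v : Fin k → Fin n)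
    (π : Equiv.Perm (Fin k)) :
    altCartPow A (u ∘ π) v = ((Equiv.Perm.sign π : ℤ) : ℝ) * altCartPow A u v := by
  unfold altCartPow
  rw [Finset.mul_sum, ← Equiv.sum_comp (Equiv.mulRight π)]
  refine Finset.sum_congr rfl fun σ _ => ?_
  simp only [Equiv.coe_mulRight, Equiv.Perm.sign_mul, Units.val_mul, Int.cast_mul,
    Equiv.Perm.coe_mul, ← Function.comp_assoc, cartPow_comp]
  ring

theorem extPow_apply {n k : ℕ} (A : Matrix (Fin n) (Fin n) ℝ)
    (S T : {S : Finset (Fin n) // S.card = k}) :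
    extPow A k S T =
      altCartPow A (enumOf inferInstance S.1 S.2) (enumOf inferInstance T.1 T.2) := by
  have hmul : ∀ (B : (Fin k → Fin n) → ℝ) (S : {S : Finset (Fin n) // S.card = k}),
      ∑ u, B u * alt n k u S = (Real.sqrt (Nat.factorial k))⁻¹ * ∑ π : Equiv.Perm (Fin k),
        ((Equiv.Perm.sign π : ℤ) : ℝ) * B (enumOf inferInstance S.1 S.2 ∘ π) := by
    intro B S
    simp only [alt, altOf, Matrix.of_apply, Finset.mul_sum]
    rw [Finset.sum_comm]
    refine Finset.sum_congr rfl fun π _ => ?_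
    rw [Finset.sum_eq_single (enumOf inferInstance S.1 S.2 ∘ π)]
    · rw [if_pos rfl]; ring
    · intro u _ hu
      rw [if_neg hu]; ring
    · simp
  have h1 : extPow A k S T = ∑ u, (∑ v, cartPow A k u v * alt n k v T) * alt n k u S := by
    rw [extPow, Matrix.mul_assoc, Matrix.mul_apply]
    refine Finset.sum_congr rfl fun u _ => ?_
    rw [Matrix.transpose_apply, Matrix.mul_apply, mul_comm]
  have h2 : ∀ u, ∑ v, cartPow A k u v * alt n k v T =
      (Real.sqrt (Nat.factorial k))⁻¹ * altCartPow A u (enumOf inferInstance T.1 T.2) :=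
    fun u => hmul _ T
  rw [h1, hmul, Finset.sum_congr rfl (g := fun _ => (Real.sqrt (Nat.factorial k))⁻¹ *
    altCartPow A (enumOf inferInstance S.1 S.2) (enumOf inferInstance T.1 T.2))]
  · rw [Finset.sum_const, Finset.card_univ, Fintype.card_perm, Fintype.card_fin, nsmul_eq_mul]
    have hk : (0 : ℝ) < (Nat.factorial k : ℝ) := by exact_mod_cast Nat.factorial_pos k
    have hs := Real.mul_self_sqrt hk.le
    have hs0 : Real.sqrt (Nat.factorial k) ≠ 0 := (Real.sqrt_pos.2 hk).ne'
    field_simp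
    rw [sq, hs]
  · intro π _
    rw [h2, altCartPow_comp_left]
    linear_combination ((Real.sqrt (Nat.factorial k))⁻¹ *
      altCartPow A (enumOf inferInstance S.1 S.2) (enumOf inferInstance T.1 T.2)) *
        sign_mul_self_real π

theorem altCartPow_update {n k : ℕ} {A : Matrix (Fin n) (Fin n) ℝ} (hA : IsSignedMatrix A)
    {u : Fin k → Fin n} {i : Fin k} {x : Fin n} (hu : Function.Injective u)
    (hv : Function.Injective (Function.update u i x)) (hx : A (u i) x ≠ 0) :
    altCartPow A u (Function.update u i x) = A (u i) x := by
  have hxu : ∀ j, u j ≠ x := by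
    intro j hj
    by_cases hji : j = i
    · subst hji
      rw [← hj, hA.2.1] at hx
      exact hx rfl
    · refine hji (hv ?_)
      rw [Function.update_of_ne hji, Function.update_self, hj]
  have zero : ∀ (σ : Equiv.Perm (Fin k)) (a : Fin k), ¬ (σ = 1 ∧ a = i) →
      A (u a) ((Function.update u i x ∘ σ) a) * ∏ j ∈ Finset.univ.erase a,
        (if u j = (Function.update u i x ∘ σ) j then (1 : ℝ) else 0) = 0 := by
    intro σ a h
    by_contra h0
    have h1 : ∀ j, j ≠ a → u j = Function.update u i x (σ j) := by
      intro j hj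
      have := Finset.prod_ne_zero_iff.1 (right_ne_zero_of_mul h0) j (by simp [hj])
      by_contra h2
      exact this (if_neg h2)
    have h2 : ∀ j, j ≠ a → σ j ≠ i ∧ σ j = j := by
      intro j hj
      have h3 : σ j ≠ i := by
        intro h3
        have := h1 j hj
        rw [h3, Function.update_self] at this
        exact hxu j this
      refine ⟨h3, ?_⟩
      have := h1 j hj
      rw [Function.update_of_ne h3] at this
      exact (hu this).symm
    have h3 : σ⁻¹ i = a := by
      by_contra h3
      exact (h2 _ h3).1 (by simp)
    have h4 : σ a = i := by rw [← h3]; simp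
    have h5 : a = i := by
      by_contra h5
      have := (h2 i (Ne.symm h5)).1
      exact this (h2 i (Ne.symm h5)).2
    refine h ⟨Equiv.ext fun j => ?_, h5⟩
    by_cases hj : j = a
    · rw [hj, h4, h5]; rfl
    · exact (h2 j hj).2
  unfold altCartPow
  rw [Finset.sum_eq_single 1]
  · simp only [cartPow, Matrix.of_apply]
    rw [Finset.sum_eq_single i]
    · rw [Finset.prod_eq_one]
      · simp
      · intro j hj
        simp [Finset.ne_of_mem_erase hj]
    · intro a _ ha
      exact zero 1 a (fun h => ha h.2)
    · simp
  · intro σ _ hσ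
    rw [cartPow, Matrix.of_apply, Finset.sum_eq_zero, mul_zero]
    exact fun a _ => zero σ a (fun h => hσ h.1)
  · simp

theorem exists_update_of_altCartPow_ne_zero {n k : ℕ} {A : Matrix (Fin n) (Fin n) ℝ}
    {u v : Fin k → Fin n} (h : altCartPow A u v ≠ 0) :
    ∃ (σ : Equiv.Perm (Fin k)) (i : Fin k) (x : Fin n),
      v ∘ σ = Function.update u i x ∧ A (u i) x ≠ 0 := by
  obtain ⟨σ, -, hσ⟩ := Finset.exists_ne_zero_of_sum_ne_zero h
  have hσ := right_ne_zero_of_mul hσ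
  rw [cartPow, Matrix.of_apply] at hσ
  obtain ⟨i, -, hi⟩ := Finset.exists_ne_zero_of_sum_ne_zero hσ
  refine ⟨σ, i, v (σ i), ?_, left_ne_zero_of_mul hi⟩
  ext1 j
  by_cases hj : j = i
  · subst hj; simp
  · rw [Function.update_of_ne hj]
    have := Finset.prod_ne_zero_iff.1 (right_ne_zero_of_mul hi) j (by simp [hj])
    by_contra h2
    exact this (if_neg (Ne.symm h2))

theorem extPow_eq_of_ne_zero {n k : ℕ} {A : Matrix (Fin n) (Fin n) ℝ} (hA : IsSignedMatrix A)
    {S T : {S : Finset (Fin n) // S.card = k}} (h : extPow A k S T ≠ 0) :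
    ∃ (σ : Equiv.Perm (Fin k)) (i : Fin k) (x : Fin n),
      enumOf inferInstance T.1 T.2 ∘ σ =
        Function.update (enumOf inferInstance S.1 S.2) i x ∧
      A (enumOf inferInstance S.1 S.2 i) x ≠ 0 ∧
      extPow A k S T =
        ((Equiv.Perm.sign σ : ℤ) : ℝ) * A (enumOf inferInstance S.1 S.2 i) x := by
  rw [extPow_apply] at h
  obtain ⟨σ, i, x, h1, h2⟩ := exists_update_of_altCartPow_ne_zero h
  refine ⟨σ, i, x, h1, h2, ?_⟩
  rw [extPow_apply]
  have h3 := altCartPow_comp_right A (enumOf inferInstance S.1 S.2)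
    (enumOf inferInstance T.1 T.2) σ
  have hinj : Function.Injective (enumOf inferInstance T.1 T.2 ∘ σ) :=
    (enumOf_strictMono T.1 T.2).injective.comp σ.injective
  rw [h1] at h3 hinj
  rw [altCartPow_update hA (enumOf_strictMono S.1 S.2).injective hinj h2] at h3
  linear_combination (-((Equiv.Perm.sign σ : ℤ) : ℝ)) * h3 -
    altCartPow A (enumOf inferInstance S.1 S.2) (enumOf inferInstance T.1 T.2) *
      sign_mul_self_real σ

theorem extPow_entry {n k : ℕ} {A : Matrix (Fin n) (Fin n) ℝ} (hA : IsSignedMatrix A)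
    (S T : {S : Finset (Fin n) // S.card = k}) :
    extPow A k S T = -1 ∨ extPow A k S T = 0 ∨ extPow A k S T = 1 := by
  by_cases h : extPow A k S T = 0
  · exact Or.inr (Or.inl h)
  · obtain ⟨σ, i, x, -, h2, h3⟩ := extPow_eq_of_ne_zero hA h
    rw [h3]
    rcases Int.units_eq_one_or (Equiv.Perm.sign σ) with h4 | h4 <;>
      rcases hA.2.2 (enumOf inferInstance S.1 S.2 i) x with h5 | h5 | h5 <;>
        first | exact absurd h5 h2 | simp [h4, h5]

theorem isBalancedMatrix_extPow_iff {n k : ℕ} {A : Matrix (Fin n) (Fin n) ℝ}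
    (hA : IsSignedMatrix A) :
    IsBalancedMatrix (extPow A k) ↔ ∃ f : (Fin k → Fin n) → ℝ, IsAltPotential A f := by
  rw [isBalancedMatrix_iff (extPow_entry hA)]
  constructor
  · rintro ⟨d, hd, h⟩
    have hval : ∀ u : Fin k → Fin n, Function.Injective u →
        Function.Injective fun i => (u i : ℕ) := fun u hu => Fin.val_injective.comp hu
    let e : Finset (Fin n) → ℝ := fun S => if hS : S.card = k then d ⟨S, hS⟩ else 1
    have he : ∀ S, e S = 1 ∨ e S = -1 := by
      intro S
      by_cases hS : S.card = k
      · simpa [e, hS] using hd ⟨S, hS⟩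
      · simp [e, hS]
    have he' : ∀ S (hS : S.card = k), e S = d ⟨S, hS⟩ := fun S hS => dif_pos hS
    refine ⟨fun u => orderSign (fun i => (u i : ℕ)) * e (Finset.univ.image u),
      ⟨fun u _ => ?_, fun u π hu => ?_, fun u i x hu hv hx => ?_⟩⟩
    · rcases orderSign_eq_or (fun i => (u i : ℕ)) with h1 | h1 <;>
        rcases he (Finset.univ.image u) with h2 | h2 <;> simp [h1, h2]
    · have h1 := orderSign_comp (hval u hu) π
      have h2 : Finset.univ.image (u ∘ π) = Finset.univ.image u := by
        rw [← Finset.image_image, Finset.image_univ_equiv]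
      rw [h2, ← mul_assoc, ← h1]
      rfl
    · obtain ⟨π, hπ⟩ := exists_eq_enumOf_comp hu
      obtain ⟨τ, hτ⟩ := exists_eq_enumOf_comp hv
      set S : {S : Finset (Fin n) // S.card = k} :=
        ⟨Finset.univ.image u, card_image_of_tuple_injective hu⟩ with hS
      set T : {S : Finset (Fin n) // S.card = k} :=
        ⟨Finset.univ.image (Function.update u i x), card_image_of_tuple_injective hv⟩ with hT
      have sgn : ∀ (w : Fin k → Fin n) (S : {S : Finset (Fin n) // S.card = k})
          (π : Equiv.Perm (Fin k)), w = enumOf inferInstance S.1 S.2 ∘ π →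
          orderSign (fun i => (w i : ℕ)) = ((Equiv.Perm.sign π : ℤ) : ℝ) := by
        intro w S π hw
        have h1 := orderSign_comp (hval _ (enumOf_strictMono S.1 S.2).injective) π
        rw [orderSign_strictMono (fun i j hij => enumOf_strictMono S.1 S.2 hij), mul_one] at h1
        rw [← h1, hw]
        rfl
      have h1 := altCartPow_update hA hu hv hx
      have h2 : altCartPow A u (Function.update u i x) =
          ((Equiv.Perm.sign π : ℤ) : ℝ) * (((Equiv.Perm.sign τ : ℤ) : ℝ) * extPow A k S T) := by
        rw [extPow_apply, ← altCartPow_comp_right, ← altCartPow_comp_left]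
        exact congrArg₂ (altCartPow A) hπ hτ
      have h3 : extPow A k S T ≠ 0 := by
        intro h3
        rw [h3, mul_zero, mul_zero] at h2
        exact hx (h1.symm.trans h2)
      rw [h S T h3] at h2
      rw [← h1, h2, sgn u S π hπ, sgn _ T τ hτ, he' _ S.2, he' _ T.2]
      ring
  · rintro ⟨f, hf⟩
    refine ⟨fun S => f (enumOf inferInstance S.1 S.2),
      fun S => hf.eq_or _ (enumOf_strictMono S.1 S.2).injective, fun S T h => ?_⟩
    obtain ⟨σ, i, x, h1, h2, h3⟩ := extPow_eq_of_ne_zero hA h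
    have hinj : Function.Injective (enumOf inferInstance T.1 T.2 ∘ σ) :=
      (enumOf_strictMono T.1 T.2).injective.comp σ.injective
    rw [h3, hf.move _ i x (enumOf_strictMono S.1 S.2).injective (h1 ▸ hinj) h2, ← h1,
      hf.comp_perm _ σ (enumOf_strictMono T.1 T.2).injective]
    linear_combination f (enumOf inferInstance S.1 S.2) * f (enumOf inferInstance T.1 T.2) *
      sign_mul_self_real σ

theorem IsSignedMatrix.abs_eq_one_iff {n : ℕ} {A : Matrix (Fin n) (Fin n) ℝ}
    (hA : IsSignedMatrix A) (i j : Fin n) : |A i j| = 1 ↔ A i j ≠ 0 := by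
  rcases hA.2.2 i j with h | h | h <;> simp [h]

theorem IsSignedMatrix.signedAdjGraph_adj {n : ℕ} {A : Matrix (Fin n) (Fin n) ℝ}
    (hA : IsSignedMatrix A) (i j : Fin n) : (signedAdjGraph A).Adj i j ↔ A i j ≠ 0 := by
  have hs : A j i = A i j := hA.1.apply i j
  rw [signedAdjGraph, SimpleGraph.fromRel_adj, hs, or_self, hA.abs_eq_one_iff]
  refine ⟨fun h => h.2, fun h => ⟨?_, h⟩⟩
  rintro rfl
  exact h (hA.2.1 i)

theorem not_isAltPotential_of_claw {n m : ℕ} (hmn : m + 4 ≤ n) {A : Matrix (Fin n) (Fin n) ℝ}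
    (hA : IsSignedMatrix A) {f : (Fin (m + 2) → Fin n) → ℝ} (hf : IsAltPotential A f)
    {a b c d : Fin n} (ha : A c a ≠ 0) (hb : A c b ≠ 0) (hd : A c d ≠ 0)
    (hab : a ≠ b) (had : a ≠ d) (hbd : b ≠ d) : False := by
  have hca : c ≠ a := fun h => ha (h ▸ hA.2.1 c)
  have hcb : c ≠ b := fun h => hb (h ▸ hA.2.1 c)
  have hcd : c ≠ d := fun h => hd (h ▸ hA.2.1 c)
  obtain ⟨e, he⟩ : ∃ e : Fin m → Fin n, Function.Injective e ∧
      ∀ i, e i ∉ ({a, b, c, d} : Finset (Fin n)) := by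
    have h1 : m ≤ (({a, b, c, d} : Finset (Fin n))ᶜ).card := by
      have := Finset.card_le_four (a := a) (b := b) (c := c) (d := d)
      rw [Finset.card_compl, Fintype.card_fin]
      omega
    obtain ⟨s, hs, hcard⟩ := Finset.exists_subset_card_eq h1
    refine ⟨fun i => s.orderIsoOfFin hcard i, fun i j hij => ?_, fun i => ?_⟩
    · exact (s.orderIsoOfFin hcard).injective (Subtype.ext hij)
    · exact Finset.mem_compl.1 (hs (s.orderIsoOfFin hcard i).2)
  let u : Fin n → Fin n → Fin (m + 2) → Fin n := fun x y => Fin.cons x (Fin.cons y e)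
  have hu : ∀ x y, x ∈ ({a, b, c, d} : Finset (Fin n)) → y ∈ ({a, b, c, d} : Finset (Fin n)) →
      x ≠ y → Function.Injective (u x y) := by
    intro x y hx hy hxy
    refine Fin.cons_injective_iff.2 ⟨?_, Fin.cons_injective_iff.2 ⟨?_, he.1⟩⟩
    · rintro ⟨i, hi⟩
      induction i using Fin.cases with
      | zero => exact hxy hi.symm
      | succ i => exact he.2 i (by rw [Fin.cons_succ] at hi; rwa [hi])
    · rintro ⟨i, hi⟩
      exact he.2 i (by rwa [hi])
  have h0 : ∀ x y x', Function.update (u x y) 0 x' = u x' y := fun x y x' =>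
    Fin.update_cons_zero _ _ _
  have h1 : ∀ x y y', Function.update (u x y) 1 y' = u x y' := by
    intro x y y'
    change Function.update (Fin.cons x (Fin.cons y e) : Fin (m + 2) → Fin n) (Fin.succ 0) y' = _
    rw [← Fin.cons_update, Fin.update_cons_zero]
  have hswap : f (u b a) = - f (u a b) := by
    have h2 := hf.comp_perm (u a b) (Equiv.swap 0 1) (hu a b (by simp) (by simp) hab)
    have h3 : u a b ∘ Equiv.swap 0 1 = u b a := by
      ext1 i
      induction i using Fin.cases with
      | zero => simp [u]
      | succ i =>
        induction i using Fin.cases with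
        | zero => simp [u]
        | succ i =>
          rw [Function.comp_apply, Equiv.swap_apply_of_ne_of_ne]
          · rfl
          · exact Fin.succ_ne_zero _
          · intro h
            exact Fin.succ_ne_zero i (Fin.succ_injective _ h)
    rw [h3, Equiv.Perm.sign_swap (by simp)] at h2
    simpa using h2
  have hs : ∀ x y, A x y = A y x := fun x y => hA.1.apply y x
  have move0 : ∀ x y x', x ∈ ({a, b, c, d} : Finset (Fin n)) →
      y ∈ ({a, b, c, d} : Finset (Fin n)) → x' ∈ ({a, b, c, d} : Finset (Fin n)) →
      x ≠ y → x' ≠ y → A x x' ≠ 0 → A x x' = f (u x y) * f (u x' y) := by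
    intro x y x' hx hy hx' hxy hxy' h
    have := hf.move (u x y) 0 x' (hu x y hx hy hxy) (by rw [h0]; exact hu x' y hx' hy hxy') h
    rwa [h0] at this
  have move1 : ∀ x y y', x ∈ ({a, b, c, d} : Finset (Fin n)) →
      y ∈ ({a, b, c, d} : Finset (Fin n)) → y' ∈ ({a, b, c, d} : Finset (Fin n)) →
      x ≠ y → x ≠ y' → A y y' ≠ 0 → A y y' = f (u x y) * f (u x y') := by
    intro x y y' hx hy hy' hxy hxy' h
    have := hf.move (u x y) 1 y' (hu x y hx hy hxy) (by rw [h1]; exact hu x y' hx hy' hxy') h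
    rwa [h1] at this
  have e1 := move1 a b c (by simp) (by simp) (by simp) hab hca.symm (by rwa [hs])
  have e2 := move1 a c d (by simp) (by simp) (by simp) hca.symm had hd
  have e3 := move0 a d c (by simp) (by simp) (by simp) had hcd (by rwa [hs])
  have e4 := move0 c d b (by simp) (by simp) (by simp) hcd hbd hb
  have e5 := move1 b d c (by simp) (by simp) (by simp) hbd hcb.symm (by rwa [hs])
  have e6 := move1 b c a (by simp) (by simp) (by simp) hcb.symm hab.symm ha
  rw [hswap] at e6
  rw [hs] at e1 e3 e5
  rw [e1] at e4
  rw [e2] at e5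
  rw [e3] at e6
  have s1 := hf.eq_or _ (hu a b (by simp) (by simp) hab)
  have s2 := hf.eq_or _ (hu a c (by simp) (by simp) hca.symm)
  have s3 := hf.eq_or _ (hu a d (by simp) (by simp) had)
  have s4 := hf.eq_or _ (hu c d (by simp) (by simp) hcd)
  have s5 := hf.eq_or _ (hu b d (by simp) (by simp) hbd)
  have s6 := hf.eq_or _ (hu b c (by simp) (by simp) hcb.symm)
  rcases s1 with s1 | s1 <;> rcases s2 with s2 | s2 <;> rcases s3 with s3 | s3 <;>
    rcases s4 with s4 | s4 <;> rcases s5 with s5 | s5 <;> rcases s6 with s6 | s6 <;>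
    revert e4 e5 e6 <;> rw [s1, s2, s3, s4, s5, s6] <;> norm_num

/-- A finite connected graph of maximum degree at most two is a path or a cycle. -/
theorem exists_path_or_cycle_enumeration {V : Type*} [Fintype V] {G : SimpleGraph V}
    (hG : G.Connected) (hcard : 3 ≤ Fintype.card V)
    (hdeg : ∀ c a b d, G.Adj c a → G.Adj c b → G.Adj c d → a = b ∨ a = d ∨ b = d) :
    ∃ p : ℕ → V, Set.InjOn p (Set.Iio (Fintype.card V)) ∧
      (∀ i, i + 1 < Fintype.card V → G.Adj (p i) (p (i + 1))) ∧
      ∀ i j, i < j → j < Fintype.card V → G.Adj (p i) (p j) →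
        j = i + 1 ∨ (i = 0 ∧ j + 1 = Fintype.card V) := by
  classical
  let P : ℕ → Prop := fun m => ∃ p : ℕ → V, Set.InjOn p (Set.Iic m) ∧
    ∀ i < m, G.Adj (p i) (p (i + 1))
  have hbound : ∀ m, P m → m < Fintype.card V := by
    rintro m ⟨p, hp, -⟩
    have h1 : (Finset.range (m + 1)).card ≤ (Finset.univ : Finset V).card := by
      refine Finset.card_le_card_of_injOn p (fun _ _ => Finset.mem_coe.2 (Finset.mem_univ _)) ?_
      intro i hi j hj hij
      simp only [Finset.coe_range, Set.mem_Iio] at hi hj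
      exact hp (Set.mem_Iic.2 (by omega)) (Set.mem_Iic.2 (by omega)) hij
    rw [Finset.card_range, Finset.card_univ] at h1
    omega
  have hP0 : P 0 := by
    obtain ⟨v⟩ := hG.nonempty
    refine ⟨fun _ => v, fun i hi j hj _ => ?_, fun i hi => absurd hi (Nat.not_lt_zero i)⟩
    rw [Set.mem_Iic] at hi hj
    omega
  set m := Nat.findGreatest P (Fintype.card V) with hm
  obtain ⟨p, hinj, hadj⟩ : P m := Nat.findGreatest_spec (Nat.zero_le _) hP0
  have hmax : ¬ P (m + 1) := fun h => by
    have := Nat.le_findGreatest (hbound _ h).le h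
    omega
  have hne : ∀ i j, i ≤ m → j ≤ m → p i = p j → i = j := fun i j hi hj h => hinj hi hj h
  have hend : ∀ y, G.Adj (p m) y → ∃ j ≤ m, p j = y := by
    intro y hy
    by_contra! hno
    refine hmax ⟨Function.update p (m + 1) y, fun i hi j hj hij => ?_, fun i hi => ?_⟩
    · rw [Set.mem_Iic] at hi hj
      by_cases hi' : i = m + 1 <;> by_cases hj' : j = m + 1
      · omega
      · rw [hi', Function.update_self, Function.update_of_ne hj'] at hij
        exact absurd hij.symm (hno j (by omega))
      · rw [hj', Function.update_self, Function.update_of_ne hi'] at hij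
        exact absurd hij (hno i (by omega))
      · rw [Function.update_of_ne hi', Function.update_of_ne hj'] at hij
        exact hne i j (by omega) (by omega) hij
    · rw [Function.update_of_ne (by omega : i ≠ m + 1)]
      by_cases hi' : i = m
      · subst hi'
        rwa [Function.update_self]
      · rw [Function.update_of_ne (by omega : i + 1 ≠ m + 1)]
        exact hadj i (by omega)
  have hstart : ∀ y, G.Adj (p 0) y → ∃ j ≤ m, p j = y := by
    intro y hy
    by_contra! hno
    refine hmax ⟨fun i => Nat.casesOn i y p, fun i hi j hj hij => ?_, fun i hi => ?_⟩
    · rw [Set.mem_Iic] at hi hj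
      rcases i with _ | i <;> rcases j with _ | j
      · rfl
      · exact absurd hij.symm (hno j (by omega))
      · exact absurd hij (hno i (by omega))
      · rw [hne i j (by omega) (by omega) hij]
    · rcases i with _ | i
      · exact hy.symm
      · exact hadj i (by omega)
  have hinner : ∀ i y, 0 < i → i < m → G.Adj (p i) y → y = p (i - 1) ∨ y = p (i + 1) := by
    intro i y h0 him hy
    have h1 : G.Adj (p i) (p (i - 1)) := by
      have := hadj (i - 1) (by omega)
      rw [Nat.sub_add_cancel h0] at this
      exact this.symm
    rcases hdeg _ _ _ _ h1 (hadj i him) hy with h | h | h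
    · have := hne _ _ (by omega) (by omega) h
      omega
    · exact Or.inl h.symm
    · exact Or.inr h.symm
  have hclosed : ∀ i y, i ≤ m → G.Adj (p i) y → ∃ j ≤ m, p j = y := by
    intro i y him hy
    rcases Nat.eq_zero_or_pos i with rfl | h0
    · exact hstart y hy
    rcases him.eq_or_lt with rfl | him
    · exact hend y hy
    rcases hinner i y h0 him hy with h | h
    · exact ⟨i - 1, by omega, h.symm⟩
    · exact ⟨i + 1, by omega, h.symm⟩
  have hsurj : ∀ y, ∃ j ≤ m, p j = y := by
    intro y
    obtain ⟨w⟩ := hG.preconnected (p 0) y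
    have : ∀ (x y : V) (w : G.Walk x y), (∃ j ≤ m, p j = x) → ∃ j ≤ m, p j = y := by
      intro x y w
      induction w with
      | nil => exact id
      | cons h _ ih =>
        rintro ⟨j, hj, rfl⟩
        exact ih (hclosed j _ hj h)
    exact this _ _ w ⟨0, Nat.zero_le _, rfl⟩
  have hcm : Fintype.card V = m + 1 := by
    refine le_antisymm ?_ (hbound m ⟨p, hinj, hadj⟩)
    have h1 : (Finset.univ : Finset V) ⊆ (Finset.range (m + 1)).image p := by
      intro y _
      obtain ⟨j, hj, rfl⟩ := hsurj y
      exact Finset.mem_image_of_mem p (Finset.mem_range.2 (by omega))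
    have h2 := (Finset.card_le_card h1).trans Finset.card_image_le
    rwa [Finset.card_range, Finset.card_univ] at h2
  rw [hcm]
  refine ⟨p, fun i hi j hj => hne i j (Nat.lt_succ_iff.1 hi) (Nat.lt_succ_iff.1 hj),
    fun i hi => hadj i (by omega), fun i j hij hj h => ?_⟩
  rcases Nat.eq_zero_or_pos i with rfl | h0
  · rcases (Nat.lt_succ_iff.1 hj).eq_or_lt with hjm | hjm
    · exact Or.inr ⟨rfl, by omega⟩
    · rcases hinner j _ hij hjm h.symm with h1 | h1
      · have := hne _ _ (by omega) (by omega) h1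
        omega
      · have := hne _ _ (by omega) (by omega) h1
        omega
  · rcases hinner i _ h0 (by omega) h with h1 | h1
    · have := hne _ _ (by omega) (by omega) h1
      omega
    · exact Or.inl (hne _ _ (by omega) (by omega) h1)

theorem prod_mul_prod_update {k : ℕ} {d : ℕ → ℝ} (hd : ∀ i, d i = 1 ∨ d i = -1)
    (w : Fin k → ℕ) (a : Fin k) (x : ℕ) :
    (∏ i, d (w i)) * ∏ i, d (Function.update w a x i) = d (w a) * d x := by
  rw [← Finset.prod_mul_distrib, Finset.prod_eq_single a]
  · rw [Function.update_self]
  · intro i _ hi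
    rw [Function.update_of_ne hi]
    rcases hd (w i) with h | h <;> simp [h]
  · simp

theorem exists_isAltPotential {n k : ℕ} {A : Matrix (Fin n) (Fin n) ℝ} (hA : IsSignedMatrix A)
    {p : ℕ → Fin n} {q : Fin n → ℕ} (hqn : ∀ x, q x < n) (hpq : ∀ x, p (q x) = x)
    {d : ℕ → ℝ} (hd : ∀ i, d i = 1 ∨ d i = -1)
    (h : ∀ i j, i < j → j < n → A (p i) (p j) ≠ 0 →
      (j = i + 1 ∧ A (p i) (p j) = d i * d j) ∨
      (i = 0 ∧ j + 1 = n ∧ A (p i) (p j) = d i * d j * (-1) ^ (k - 1))) :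
    ∃ f : (Fin k → Fin n) → ℝ, IsAltPotential A f := by
  have hq : Function.Injective q := Function.LeftInverse.injective hpq
  have hdprod : ∀ w : Fin k → ℕ, ∏ i, d (w i) = 1 ∨ ∏ i, d (w i) = -1 := fun w => by
    refine Finset.prod_induction _ (fun x : ℝ => x = 1 ∨ x = -1) ?_ (Or.inl rfl) fun i _ => hd _
    rintro a b (rfl | rfl) (rfl | rfl) <;> simp
  refine ⟨fun u => orderSign (q ∘ u) * ∏ i, d ((q ∘ u) i),
    ⟨fun u _ => ?_, fun u π hu => ?_, fun u a x hu hv hx => ?_⟩⟩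
  · rcases orderSign_eq_or (q ∘ u) with h1 | h1 <;>
      rcases hdprod (q ∘ u) with h2 | h2 <;> simp only [h1, h2] <;> norm_num
  · have h1 := orderSign_comp (hq.comp hu) π
    have h2 : ∏ i, d (((q ∘ u) ∘ π) i) = ∏ i, d ((q ∘ u) i) :=
      Equiv.prod_comp π fun i => d ((q ∘ u) i)
    simp only [h2, ← Function.comp_assoc, h1]
    ring
  · have hup : q ∘ Function.update u a x = Function.update (q ∘ u) a (q x) :=
      Function.comp_update _ _ _ _
    have hw : ∀ j, j ≠ a → q (u j) ≠ q (u a) ∧ q (u j) ≠ q x := by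
      intro j hj
      refine ⟨fun h => hj (hu (hq h)), fun h => hj (hv ?_)⟩
      rw [Function.update_of_ne hj, Function.update_self, hq h]
    have hne : q (u a) ≠ q x := fun h => hx (by rw [hq h, hA.2.1])
    have hadj : ∀ y z, q y < q z → A y z ≠ 0 →
        (q z = q y + 1 ∧ A y z = d (q y) * d (q z)) ∨
        (q y = 0 ∧ q z + 1 = n ∧ A y z = d (q y) * d (q z) * (-1) ^ (k - 1)) := by
      intro y z hyz h0
      have := h (q y) (q z) hyz (hqn z)
      rw [hpq, hpq] at this
      exact this h0
    have hbound : ∀ j, q (u j) < n := fun j => hqn _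
    have hcases : (A (u a) x = d (q (u a)) * d (q x) ∧
          (q x = q (u a) + 1 ∨ q (u a) = q x + 1)) ∨
        (A (u a) x = d (q (u a)) * d (q x) * (-1) ^ (k - 1) ∧
          ((q (u a) = 0 ∧ q x + 1 = n) ∨ (q x = 0 ∧ q (u a) + 1 = n))) := by
      rcases lt_or_gt_of_ne hne with hlt | hlt
      · rcases hadj _ _ hlt hx with ⟨h1, h2⟩ | ⟨h1, h2, h3⟩
        · exact Or.inl ⟨h2, Or.inl h1⟩
        · exact Or.inr ⟨h3, Or.inl ⟨h1, h2⟩⟩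
      · have hs : A x (u a) = A (u a) x := hA.1.apply _ _
        rcases hadj _ _ hlt (by rwa [hs]) with ⟨h1, h2⟩ | ⟨h1, h2, h3⟩
        · exact Or.inl ⟨by rw [← hs, h2, mul_comm], Or.inr h1⟩
        · exact Or.inr ⟨by rw [← hs, h3, mul_comm (d (q x))], Or.inr ⟨h1, h2⟩⟩
    have hprod := prod_mul_prod_update hd (q ∘ u) a (q x)
    have hsign : ∀ ε : ℝ,
        orderSign (q ∘ u) * orderSign (Function.update (q ∘ u) a (q x)) = ε →
        A (u a) x = d (q (u a)) * d (q x) * ε →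
        A (u a) x = (orderSign (q ∘ u) * ∏ i, d ((q ∘ u) i)) *
          (orderSign (q ∘ Function.update u a x) *
            ∏ i, d ((q ∘ Function.update u a x) i)) := by
      intro ε h1 h2
      rw [hup, h2, ← h1]
      simp only [Function.comp_apply] at hprod ⊢
      rw [← hprod]
      ring
    rcases hcases with ⟨h1, h2⟩ | ⟨h1, h2⟩
    · refine hsign 1 ?_ (by rw [h1, mul_one])
      rw [orderSign_mul_update _ a (q x) 1, one_pow]
      all_goals
        intro j hj
        have h3 := hw j hj
        simp only [Function.comp_apply]
        split_ifs <;> first | omega | norm_num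
    · refine hsign ((-1) ^ (k - 1)) ?_ h1
      rw [orderSign_mul_update _ a (q x) (-1)]
      all_goals
        intro j hj
        have h3 := hw j hj
        have h4 := hbound j
        simp only [Function.comp_apply]
        split_ifs <;> first | omega | norm_num

/-- Moving all entries of a tuple once around a cycle permutes them cyclically, which determines
the sign of the cycle. -/
theorem IsAltPotential.closing_edge {n m : ℕ} (hm : m + 1 < n) {A : Matrix (Fin n) (Fin n) ℝ}
    {f : (Fin (m + 1) → Fin n) → ℝ} (hf : IsAltPotential A f)
    {p : ℕ → Fin n} (hp : Set.InjOn p (Set.Iio n))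
    {d : ℕ → ℝ} (hd : ∀ i, d i = 1 ∨ d i = -1)
    (hpath : ∀ i, i + 1 < n → A (p i) (p (i + 1)) = d i * d (i + 1))
    (hclose : A (p (n - 1)) (p 0) ≠ 0) :
    A (p (n - 1)) (p 0) = d (n - 1) * d 0 * (-1) ^ m := by
  let F : (Fin (m + 1) → ℕ) → ℝ := fun w => f (p ∘ w) * ∏ i, d (w i)
  have hinj : ∀ w : Fin (m + 1) → ℕ, Function.Injective w → (∀ i, w i < n) →
      Function.Injective (p ∘ w) := fun w h1 h2 i j hij => h1 (hp (h2 i) (h2 j) hij)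
  have hF : ∀ w : Fin (m + 1) → ℕ, Function.Injective w → (∀ i, w i < n) →
      F w = 1 ∨ F w = -1 := by
    intro w h1 h2
    have h3 : ∏ i, d (w i) = 1 ∨ ∏ i, d (w i) = -1 := by
      refine Finset.prod_induction _ (fun x : ℝ => x = 1 ∨ x = -1) ?_ (Or.inl rfl)
        fun i _ => hd _
      rintro a b (rfl | rfl) (rfl | rfl) <;> simp
    rcases hf.eq_or _ (hinj w h1 h2) with h4 | h4 <;> rcases h3 with h3 | h3 <;>
      simp only [F, h3, h4] <;> norm_num
  have hmove : ∀ (w : Fin (m + 1) → ℕ) (a : Fin (m + 1)) (x : ℕ), Function.Injective w →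
      (∀ i, w i < n) → Function.Injective (Function.update w a x) →
      (∀ i, Function.update w a x i < n) → A (p (w a)) (p x) ≠ 0 →
      F w * F (Function.update w a x) = A (p (w a)) (p x) * (d (w a) * d x) := by
    intro w a x h1 h2 h3 h4 h5
    have hup : p ∘ Function.update w a x = Function.update (p ∘ w) a (p x) :=
      Function.comp_update _ _ _ _
    have h6 := hf.move (p ∘ w) a (p x) (hinj w h1 h2) (hup ▸ hinj _ h3 h4) h5
    rw [← prod_mul_prod_update hd w a x]
    simp only [F, hup]
    rw [Function.comp_apply] at h6
    rw [h6]
    ring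
  have hmono : ∀ (N : ℕ) (w : Fin (m + 1) → ℕ), ∑ i, w i = N → StrictMono w →
      (∀ i, w i < n) → F w = F fun i => (i : ℕ) := by
    intro N
    induction N using Nat.strong_induction_on with
    | _ N ih =>
      intro w hN hw hwn
      by_cases hval : ∀ i, w i = i
      · exact congrArg F (funext hval)
      push Not at hval
      obtain ⟨i, hi, hmin⟩ := WellFounded.has_min (wellFounded_lt (α := Fin (m + 1)))
        {i | w i ≠ i} hval
      rw [Set.mem_ofPred_eq] at hi
      have hlow : ∀ j < i, w j = j := by
        intro j hj
        by_contra h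
        exact hmin j h hj
      have hgt : (i : ℕ) < w i := by
        refine lt_of_le_of_ne ?_ (Ne.symm hi)
        rcases Nat.eq_zero_or_pos (i : ℕ) with h0 | h0
        · omega
        · have hlt : (⟨i - 1, by omega⟩ : Fin (m + 1)) < i := by
            rw [Fin.lt_def]
            simp only
            omega
          have h1 := hw hlt
          rw [hlow _ hlt] at h1
          simp only at h1
          omega
      have hw' : StrictMono (Function.update w i (w i - 1)) := by
        intro a b hab
        by_cases ha : a = i
        · subst ha
          rw [Function.update_self, Function.update_of_ne hab.ne']
          have := hw hab
          omega
        · rw [Function.update_of_ne ha]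
          by_cases hb : b = i
          · subst hb
            rw [Function.update_self, hlow a hab]
            rw [Fin.lt_def] at hab
            omega
          · rw [Function.update_of_ne hb]
            exact hw hab
      have hwn' : ∀ j, Function.update w i (w i - 1) j < n := by
        intro j
        by_cases hj : j = i
        · subst hj
          rw [Function.update_self]
          have := hwn j
          omega
        · rw [Function.update_of_ne hj]
          exact hwn j
      have hback : Function.update (Function.update w i (w i - 1)) i (w i) = w := by simp
      have hedge := hpath (w i - 1) (by have := hwn i; omega)
      rw [Nat.sub_add_cancel (by omega)] at hedge
      have hne : A (p (w i - 1)) (p (w i)) ≠ 0 := by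
        rw [hedge]
        rcases hd (w i - 1) with h | h <;> rcases hd (w i) with h' | h' <;> simp [h, h']
      have h1 := hmove (Function.update w i (w i - 1)) i (w i) hw'.injective hwn'
        (by rw [hback]; exact hw.injective) (by rw [hback]; exact hwn)
        (by rwa [Function.update_self])
      rw [hback, Function.update_self, hedge] at h1
      have h2 : F w = F (Function.update w i (w i - 1)) := by
        rcases hF _ hw'.injective hwn' with h3 | h3 <;> rcases hF _ hw.injective hwn with h4 | h4 <;>
          rcases hd (w i - 1) with h5 | h5 <;> rcases hd (w i) with h6 | h6 <;>
          rw [h3, h4, h5, h6] at h1 <;> rw [h3, h4] <;> norm_num at h1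
      rw [h2]
      refine ih _ ?_ _ rfl hw' hwn'
      rw [← hN]
      refine Finset.sum_lt_sum (fun j _ => ?_) ⟨i, Finset.mem_univ i, ?_⟩
      · by_cases hj : j = i
        · subst hj
          rw [Function.update_self]
          omega
        · rw [Function.update_of_ne hj]
      · rw [Function.update_self]
        omega
  let w₁ : Fin (m + 1) → ℕ := fun i => if (i : ℕ) < m then i + 1 else n - 1
  have hw₁ : StrictMono w₁ := by
    intro a b hab
    rw [Fin.lt_def] at hab
    simp only [w₁]
    split_ifs <;> omega
  have hw₁n : ∀ i, w₁ i < n := by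
    intro i
    simp only [w₁]
    split_ifs <;> omega
  have hlast : w₁ (Fin.last m) = n - 1 := by simp [w₁]
  have hval : Function.Injective fun i : Fin (m + 1) => (i : ℕ) := Fin.val_injective
  have hrot : Function.update w₁ (Fin.last m) 0 =
      (fun i : Fin (m + 1) => (i : ℕ)) ∘ finRotate (m + 1) := by
    ext i
    by_cases hi : i = Fin.last m
    · subst hi
      simp
    · rw [Function.update_of_ne hi, Function.comp_apply, coe_finRotate_of_ne_last hi]
      have : (i : ℕ) < m := by
        have h1 := i.2
        have h2 : (i : ℕ) ≠ m := fun h => hi (Fin.ext h)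
        omega
      simp [w₁, this]
  have hrotn : ∀ i, Function.update w₁ (Fin.last m) 0 i < n := by
    intro i
    rw [hrot, Function.comp_apply]
    omega
  have h1 := hmove w₁ (Fin.last m) 0 hw₁.injective hw₁n
    (by rw [hrot]; exact hval.comp (finRotate _).injective) hrotn (by rwa [hlast])
  have h2 : F (Function.update w₁ (Fin.last m) 0) = (-1) ^ m * F fun i => (i : ℕ) := by
    rw [hrot]
    have h3 := hf.comp_perm (p ∘ fun i : Fin (m + 1) => (i : ℕ)) (finRotate (m + 1))
      (hinj _ hval fun i => by omega)
    rw [sign_finRotate] at h3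
    have h4 : ∏ i, d (((fun i : Fin (m + 1) => (i : ℕ)) ∘ finRotate (m + 1)) i) =
        ∏ i : Fin (m + 1), d i :=
      Equiv.prod_comp (finRotate (m + 1)) fun i => d i
    simp only [F, h4, ← Function.comp_assoc, h3]
    push_cast
    ring
  rw [h2, hmono _ w₁ rfl hw₁ hw₁n, hlast] at h1
  have h3 := hF (fun i => (i : ℕ)) hval fun i => by omega
  have h4 : (F fun i => (i : ℕ)) * (F fun i => (i : ℕ)) = 1 := by
    rcases h3 with h | h <;> rw [h] <;> norm_num
  have h5 : (d (n - 1) * d 0) * (d (n - 1) * d 0) = 1 := by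
    rcases hd (n - 1) with h | h <;> rcases hd 0 with h' | h' <;> rw [h, h'] <;> norm_num
  linear_combination (-(d (n - 1) * d 0)) * h1 - A (p (n - 1)) (p 0) * h5 +
    (d (n - 1) * d 0) * (-1) ^ m * h4

theorem exists_sign_primitive {s : ℕ → ℝ} (hs : ∀ i, s i = 1 ∨ s i = -1) :
    ∃ d : ℕ → ℝ, (∀ i, d i = 1 ∨ d i = -1) ∧ ∀ i, s i = d i * d (i + 1) := by
  have hd : ∀ i, ∏ j ∈ Finset.range i, s j = 1 ∨ ∏ j ∈ Finset.range i, s j = -1 := fun i => by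
    refine Finset.prod_induction _ (fun x : ℝ => x = 1 ∨ x = -1) ?_ (Or.inl rfl) fun i _ => hs _
    rintro a b (rfl | rfl) (rfl | rfl) <;> simp
  refine ⟨fun i => ∏ j ∈ Finset.range i, s j, hd, fun i => ?_⟩
  beta_reduce
  rw [Finset.prod_range_succ]
  rcases hd i with h | h <;> simp [h]

theorem IsSignedMatrix.exists_path_signs {n : ℕ} {A : Matrix (Fin n) (Fin n) ℝ}
    (hA : IsSignedMatrix A) {p : ℕ → Fin n}
    (hpath : ∀ i, i + 1 < n → A (p i) (p (i + 1)) ≠ 0) :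
    ∃ d : ℕ → ℝ, (∀ i, d i = 1 ∨ d i = -1) ∧
      ∀ i, i + 1 < n → A (p i) (p (i + 1)) = d i * d (i + 1) := by
  obtain ⟨d, hd, h⟩ := exists_sign_primitive
    (s := fun i => if i + 1 < n then A (p i) (p (i + 1)) else 1) (by
      intro i
      split_ifs with hi
      · rcases hA.2.2 (p i) (p (i + 1)) with h | h | h
        · exact Or.inr h
        · exact absurd h (hpath i hi)
        · exact Or.inl h
      · exact Or.inl rfl)
  refine ⟨d, hd, fun i hi => ?_⟩
  rw [← h i, if_pos hi]

theorem exists_enumeration_inverse {n : ℕ} {p : ℕ → Fin n} (hp : Set.InjOn p (Set.Iio n)) :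
    ∃ q : Fin n → ℕ, (∀ x, q x < n) ∧ ∀ x, p (q x) = x := by
  have hinj : Function.Injective fun i : Fin n => p i := fun i j hij =>
    Fin.ext (hp i.2 j.2 hij)
  choose q hq using Finite.surjective_of_injective hinj
  exact ⟨fun x => q x, fun x => (q x).2, hq⟩

theorem exists_enumeration_of_perm {n : ℕ} (hn : 0 < n) (g : Equiv.Perm (Fin n)) :
    ∃ p : ℕ → Fin n, Set.InjOn p (Set.Iio n) ∧ ∀ i : Fin n, p i = g i := by
  refine ⟨fun i => if h : i < n then g ⟨i, h⟩ else ⟨0, hn⟩, fun i hi j hj hij => ?_,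
    fun i => dif_pos i.2⟩
  simp only [dif_pos (Set.mem_Iio.1 hi), dif_pos (Set.mem_Iio.1 hj)] at hij
  exact congrArg Fin.val (g.injective hij)

theorem exists_perm_of_enumeration {n : ℕ} {p : ℕ → Fin n} (hp : Set.InjOn p (Set.Iio n)) :
    ∃ g : Equiv.Perm (Fin n), ∀ i : Fin n, g i = p i := by
  have hinj : Function.Injective fun i : Fin n => p i := fun i j hij =>
    Fin.ext (hp i.2 j.2 hij)
  exact ⟨Equiv.ofBijective _ (Finite.injective_iff_bijective.1 hinj), fun i => rfl⟩

/-- A symmetric relation can be checked on increasing pairs. -/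
theorem IsSignedMatrix.forall_abs_eq_one_iff {n : ℕ} (hn : 0 < n)
    {A : Matrix (Fin n) (Fin n) ℝ} (hA : IsSignedMatrix A) {Q : ℕ → ℕ → Prop}
    (hQ : ∀ i < n, ∀ j < n, Q i j → Q j i) (hQ' : ∀ i < n, ¬ Q i i) :
    (∃ g : Equiv.Perm (Fin n), ∀ i j : Fin n, |A (g i) (g j)| = 1 ↔ Q i j) ↔
      ∃ p : ℕ → Fin n, Set.InjOn p (Set.Iio n) ∧
        ∀ i j, i < j → j < n → (A (p i) (p j) ≠ 0 ↔ Q i j) := by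
  simp only [hA.abs_eq_one_iff]
  constructor
  · rintro ⟨g, hg⟩
    obtain ⟨p, hp, hpg⟩ := exists_enumeration_of_perm hn g
    refine ⟨p, hp, fun i j hij hj => ?_⟩
    have := hg ⟨i, hij.trans hj⟩ ⟨j, hj⟩
    rwa [← hpg, ← hpg] at this
  · rintro ⟨p, hp, h⟩
    obtain ⟨g, hg⟩ := exists_perm_of_enumeration hp
    refine ⟨g, fun i j => ?_⟩
    rw [hg, hg]
    rcases lt_trichotomy (i : ℕ) j with hij | hij | hij
    · exact h i j hij j.2
    · rw [hij]
      exact iff_of_false (fun h => h (hA.2.1 _)) (hQ' j j.2)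
    · rw [← hA.1.apply, h j i hij i.2]
      exact ⟨hQ j j.2 i i.2, hQ i i.2 j j.2⟩

theorem IsSignedMatrix.isPathMatrix_iff {n : ℕ} (hn : 0 < n) {A : Matrix (Fin n) (Fin n) ℝ}
    (hA : IsSignedMatrix A) :
    IsPathMatrix A ↔ ∃ p : ℕ → Fin n, Set.InjOn p (Set.Iio n) ∧
      ∀ i j, i < j → j < n → (A (p i) (p j) ≠ 0 ↔ j = i + 1) := by
  rw [IsPathMatrix, hA.forall_abs_eq_one_iff hn
    (Q := fun i j => (i : ℤ) - j = 1 ∨ (j : ℤ) - i = 1) (by omega) (by omega)]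
  refine exists_congr fun p => and_congr_right fun _ => forall_congr' fun i =>
    forall_congr' fun j => forall_congr' fun hij => forall_congr' fun _ => ?_
  rw [show ((i : ℤ) - j = 1 ∨ (j : ℤ) - i = 1) ↔ j = i + 1 by omega]

theorem cyclic_adjacent_iff {n i j : ℕ} (hij : i < j) (hj : j < n) :
    ((i : ℤ) - j ≡ 1 [ZMOD (n : ℤ)] ∨ (i : ℤ) - j ≡ -1 [ZMOD (n : ℤ)]) ↔
      j = i + 1 ∨ (i = 0 ∧ j + 1 = n) := by
  rw [Int.modEq_comm, Int.modEq_iff_dvd, Int.modEq_comm, Int.modEq_iff_dvd]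
  constructor
  · rintro (⟨c, hc⟩ | ⟨c, hc⟩)
    · have h1 : c = -1 := by
        have h2 : c < 0 := by by_contra h; nlinarith
        have h3 : -2 < c := by by_contra h; nlinarith
        omega
      subst h1
      omega
    · have h1 : c = 0 := by
        have h2 : c < 1 := by by_contra h; nlinarith
        have h3 : -1 < c := by by_contra h; nlinarith
        omega
      subst h1
      omega
  · rintro (h | h)
    · exact Or.inr ⟨0, by omega⟩
    · exact Or.inl ⟨-1, by omega⟩

theorem IsSignedMatrix.isCycleMatrix_iff {n : ℕ} {A : Matrix (Fin n) (Fin n) ℝ}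
    (hA : IsSignedMatrix A) :
    IsCycleMatrix A ↔ 3 ≤ n ∧ ∃ p : ℕ → Fin n, Set.InjOn p (Set.Iio n) ∧
      ∀ i j, i < j → j < n → (A (p i) (p j) ≠ 0 ↔ j = i + 1 ∨ (i = 0 ∧ j + 1 = n)) := by
  refine and_congr_right fun hn => ?_
  rw [hA.forall_abs_eq_one_iff (by omega)
    (Q := fun i j => (i : ℤ) - j ≡ 1 [ZMOD (n : ℤ)] ∨ (i : ℤ) - j ≡ -1 [ZMOD (n : ℤ)])]
  · refine exists_congr fun p => and_congr_right fun _ => forall_congr' fun i =>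
      forall_congr' fun j => forall_congr' fun hij => forall_congr' fun hj => ?_
    rw [cyclic_adjacent_iff hij hj]
  · rintro i - j - (h | h)
    · right
      have := h.neg
      rwa [neg_sub] at this
    · left
      have := h.neg
      rwa [neg_sub, neg_neg] at this
  · rintro i - (h | h)
    · rw [sub_self, Int.modEq_iff_dvd] at h
      have := Int.le_of_dvd (by norm_num) h
      omega
    · rw [sub_self, Int.modEq_comm, Int.modEq_iff_dvd] at h
      have := Int.le_of_dvd (by norm_num) h
      omega

theorem IsSignedMatrix.isBalancedMatrix_cycle_iff {n : ℕ} (hn : 0 < n)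
    {A : Matrix (Fin n) (Fin n) ℝ} (hA : IsSignedMatrix A)
    {p : ℕ → Fin n} (hp : Set.InjOn p (Set.Iio n))
    {d : ℕ → ℝ} (hd : ∀ i, d i = 1 ∨ d i = -1)
    (hpath : ∀ i, i + 1 < n → A (p i) (p (i + 1)) = d i * d (i + 1))
    (hclose : A (p (n - 1)) (p 0) ≠ 0)
    (h : ∀ i j, i < j → j < n → A (p i) (p j) ≠ 0 → j = i + 1 ∨ (i = 0 ∧ j + 1 = n)) :
    IsBalancedMatrix A ↔ A (p (n - 1)) (p 0) = d (n - 1) * d 0 := by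
  rw [isBalancedMatrix_iff hA.2.2]
  constructor
  · rintro ⟨e, he, hAe⟩
    have h1 : ∀ i, i < n → d i * d 0 = e (p i) * e (p 0) := by
      intro i
      induction i with
      | zero =>
        intro _
        rcases hd 0 with h | h <;> rcases he (p 0) with h' | h' <;> rw [h, h']
        all_goals norm_num
      | succ i ih =>
        intro hi
        have h2 := ih (by omega)
        have h3 := hpath i hi
        have h4 : A (p i) (p (i + 1)) ≠ 0 := by
          rw [h3]
          rcases hd i with h | h <;> rcases hd (i + 1) with h' | h' <;> simp [h, h']
        rw [hAe _ _ h4] at h3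
        have h5 : d i * d i = 1 := by rcases hd i with h | h <;> rw [h] <;> norm_num
        have h6 : e (p i) * e (p i) = 1 := by
          rcases he (p i) with h | h <;> rw [h] <;> norm_num
        linear_combination (-d (i + 1) * d 0) * h5 + (d i * d (i + 1)) * h2 -
          (e (p i) * e (p 0)) * h3 + (e (p (i + 1)) * e (p 0)) * h6
    rw [h1 _ (by omega)]
    exact hAe _ _ hclose
  · intro hc
    obtain ⟨q, hqn, hpq⟩ := exists_enumeration_inverse hp
    have hlt : ∀ x y, q x < q y → A x y ≠ 0 → A x y = d (q x) * d (q y) := by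
      intro x y hxy h0
      have h1 := h (q x) (q y) hxy (hqn y) (by rwa [hpq, hpq])
      rcases h1 with h1 | ⟨h1, h2⟩
      · have h2 := hpath (q x) (by rw [← h1]; exact hqn y)
        rwa [← h1, hpq, hpq] at h2
      · have h3 : q y = n - 1 := by omega
        rw [← h3, ← h1, hpq, hpq] at hc
        rw [← hA.1.apply, hc, mul_comm]
    refine ⟨fun x => d (q x), fun x => hd _, fun x y hxy => ?_⟩
    rcases lt_trichotomy (q x) (q y) with h1 | h1 | h1
    · exact hlt x y h1 hxy
    · rw [← hpq x, ← hpq y, h1, hA.2.1] at hxy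
      exact absurd rfl hxy
    · rw [← hA.1.apply] at hxy ⊢
      rw [hlt y x h1 hxy, mul_comm]

theorem stmt0 {n k : ℕ} (hn : 4 ≤ n) (hk2 : 2 ≤ k) (hkn : k ≤ n - 2)
    (A : Matrix (Fin n) (Fin n) ℝ) (hA : IsSignedMatrix A)
    (hconn : (signedAdjGraph A).Connected) :
    IsBalancedMatrix (extPow A k) ↔
      IsPathMatrix A ∨ (IsCycleMatrix A ∧ (IsBalancedMatrix A ↔ Odd k)) := by
  obtain ⟨m, rfl⟩ : ∃ m, k = m + 2 := ⟨k - 2, by omega⟩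
  have hparity : ∀ x : ℝ, x = 1 ∨ x = -1 → (x * (-1) ^ (m + 1) = x ↔ Odd (m + 2)) := by
    intro x hx
    rcases Nat.even_or_odd (m + 1) with h | h
    · rw [h.neg_one_pow, mul_one]
      exact iff_of_true rfl h.add_one
    · rw [h.neg_one_pow]
      refine iff_of_false ?_ (Nat.not_odd_iff_even.2 h.add_one)
      rcases hx with rfl | rfl <;> norm_num
  have hdd : ∀ d : ℕ → ℝ, (∀ i, d i = 1 ∨ d i = -1) → ∀ i j, d i * d j = 1 ∨ d i * d j = -1 := by
    intro d hd i j
    rcases hd i with h | h <;> rcases hd j with h' | h' <;> simp [h, h']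
  rw [isBalancedMatrix_extPow_iff hA, hA.isPathMatrix_iff (by omega), hA.isCycleMatrix_iff]
  constructor
  · rintro ⟨f, hf⟩
    obtain ⟨p, hp, hpath, hedge⟩ := exists_path_or_cycle_enumeration hconn
      (by rw [Fintype.card_fin]; omega) (by
        intro c a b d ha hb hd
        rw [hA.signedAdjGraph_adj] at ha hb hd
        by_contra! hne
        exact not_isAltPotential_of_claw (by omega) hA hf ha hb hd hne.1 hne.2.1 hne.2.2)
    simp only [Fintype.card_fin, hA.signedAdjGraph_adj] at hp hpath hedge
    by_cases hclose : A (p (n - 1)) (p 0) = 0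
    · refine Or.inl ⟨p, hp, fun i j hij hj => ⟨fun h => ?_, ?_⟩⟩
      · rcases hedge i j hij hj h with h1 | ⟨rfl, h1⟩
        · exact h1
        · rw [← hA.1.apply, show j = n - 1 by omega] at h
          exact absurd hclose h
      · rintro rfl
        exact hpath i hj
    · refine Or.inr ⟨⟨by omega, p, hp, fun i j hij hj => ⟨hedge i j hij hj, ?_⟩⟩, ?_⟩
      · rintro (rfl | ⟨rfl, h1⟩)
        · exact hpath i hj
        · rwa [← hA.1.apply, show j = n - 1 by omega]
      · obtain ⟨d, hd, hpathd⟩ := hA.exists_path_signs hpath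
        rw [hA.isBalancedMatrix_cycle_iff (by omega) hp hd hpathd hclose hedge,
          hf.closing_edge (by omega) hp hd hpathd hclose]
        exact hparity _ (hdd d hd _ _)
  · rintro (⟨p, hp, h⟩ | ⟨⟨-, p, hp, h⟩, hodd⟩)
    · obtain ⟨q, hqn, hpq⟩ := exists_enumeration_inverse hp
      obtain ⟨d, hd, hpathd⟩ := hA.exists_path_signs fun i hi => (h i _ i.lt_succ_self hi).2 rfl
      refine exists_isAltPotential hA hqn hpq hd fun i j hij hj h0 => Or.inl ?_
      obtain rfl := (h i j hij hj).1 h0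
      exact ⟨rfl, hpathd i hj⟩
    · obtain ⟨q, hqn, hpq⟩ := exists_enumeration_inverse hp
      obtain ⟨d, hd, hpathd⟩ := hA.exists_path_signs
        fun i hi => (h i _ i.lt_succ_self hi).2 (Or.inl rfl)
      have hclose : A (p (n - 1)) (p 0) ≠ 0 := by
        rw [← hA.1.apply]
        exact (h 0 (n - 1) (by omega) (by omega)).2 (Or.inr ⟨rfl, by omega⟩)
      have hcd : A (p (n - 1)) (p 0) = d (n - 1) * d 0 * (-1) ^ (m + 1) := by
        rw [hA.isBalancedMatrix_cycle_iff (by omega) hp hd hpathd hclose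
          fun i j hij hj => (h i j hij hj).1, ← hparity _ (hdd d hd (n - 1) 0)] at hodd
        have h1 := hdd d hd (n - 1) 0
        generalize d (n - 1) * d 0 = x at h1 hodd ⊢
        have h2 := hA.2.2 (p (n - 1)) (p 0)
        generalize A (p (n - 1)) (p 0) = y at h2 hodd hclose ⊢
        rcases neg_one_pow_eq_or ℝ (m + 1) with h3 | h3 <;> rw [h3] <;> rw [h3] at hodd <;>
          rcases h1 with rfl | rfl <;> rcases h2 with rfl | rfl | rfl <;>
          revert hodd hclose <;> norm_num
      refine exists_isAltPotential hA hqn hpq hd fun i j hij hj h0 => ?_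
      rcases (h i j hij hj).1 h0 with rfl | ⟨rfl, h1⟩
      · exact Or.inl ⟨rfl, hpathd i hj⟩
      · refine Or.inr ⟨rfl, h1, ?_⟩
        rw [← hA.1.apply, show j = n - 1 by omega, hcd, mul_comm (d 0)]
        rfl
end

section
/- Let A be a signed graph on n vertices, let 1 ≤ k ≤ n−1, and let S, T be k-element subsets of Fin n. If S \ T = {a} and T \ S = {b} for some vertices a, b, then (∧^k A)(S,T) = (−1)^m * A(a,b), where m is the number of elements x ∈ S ∩ T with min(a,b) < x < max(a,b). In all other cases (in particular when S = T or when the symmetric difference S △ T has more than two elements), (∧^k A)(S,T) = 0. -/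
open Matrix Finset

theorem cartPow_comp_perm {n k : ℕ} (A : Matrix (Fin n) (Fin n) ℝ) (u v : Fin k → Fin n)
    (ρ : Equiv.Perm (Fin k)) : cartPow A k (u ∘ ρ) (v ∘ ρ) = cartPow A k u v := by
  simp only [cartPow, Matrix.of_apply, Function.comp_apply]
  refine Fintype.sum_equiv ρ _ _ fun i => ?_
  congr 1
  refine Finset.prod_bij (fun j _ => ρ j) ?_ ?_ ?_ ?_
  · intro j hj
    simpa using hj
  · intro j _ j' _ h
    exact ρ.injective h
  · intro j hj
    exact ⟨ρ.symm j, by simpa [Equiv.symm_apply_eq] using hj, by simp⟩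
  · intro j _
    rfl

theorem enumOf_eq_orderEmbOfFin {n k : ℕ} (S : Finset (Fin n)) (h : S.card = k) :
    enumOf inferInstance S h = ⇑(S.orderEmbOfFin h) :=
  rfl

/-- The entries of the exterior power as a single alternating sum. -/
theorem extPow_eq_sum_perm {n k : ℕ} (A : Matrix (Fin n) (Fin n) ℝ)
    (S T : {S : Finset (Fin n) // S.card = k}) :
    extPow A k S T = ∑ σ : Equiv.Perm (Fin k), ((Equiv.Perm.sign σ : ℤ) : ℝ) *
      cartPow A k (S.1.orderEmbOfFin S.2) (T.1.orderEmbOfFin T.2 ∘ σ) := by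
  set s : Fin k → Fin n := ⇑(S.1.orderEmbOfFin S.2) with hs
  set t : Fin k → Fin n := ⇑(T.1.orderEmbOfFin T.2) with ht
  set c : ℝ := (Real.sqrt (Nat.factorial k))⁻¹ with hc
  have hcc : c * c * (Nat.factorial k : ℝ) = 1 := by
    rw [hc, ← mul_inv, Real.mul_self_sqrt (Nat.cast_nonneg _)]
    exact inv_mul_cancel₀ (by exact_mod_cast Nat.factorial_ne_zero k)
  have expand : extPow A k S T = c * c * ∑ π : Equiv.Perm (Fin k), ∑ σ : Equiv.Perm (Fin k),
      ((Equiv.Perm.sign π : ℤ) : ℝ) * ((Equiv.Perm.sign σ : ℤ) : ℝ) *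
        cartPow A k (s ∘ π) (t ∘ σ) := by
    have left : ∀ f : (Fin k → Fin n) → ℝ, ∑ u, alt n k u S * f u =
        c * ∑ π : Equiv.Perm (Fin k), ((Equiv.Perm.sign π : ℤ) : ℝ) * f (s ∘ π) := by
      intro f
      simp only [alt, altOf, Matrix.of_apply, enumOf_eq_orderEmbOfFin, mul_assoc, ← hc, ← hs,
        ← Finset.mul_sum, Finset.sum_mul, ite_mul, zero_mul]
      rw [Finset.sum_comm]
      simp
    have right : ∀ f : (Fin k → Fin n) → ℝ, ∑ u, alt n k u T * f u =
        c * ∑ π : Equiv.Perm (Fin k), ((Equiv.Perm.sign π : ℤ) : ℝ) * f (t ∘ π) := by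
      intro f
      simp only [alt, altOf, Matrix.of_apply, enumOf_eq_orderEmbOfFin, mul_assoc, ← hc, ← ht,
        ← Finset.mul_sum, Finset.sum_mul, ite_mul, zero_mul]
      rw [Finset.sum_comm]
      simp
    rw [extPow, Matrix.mul_assoc, Matrix.mul_apply]
    simp only [Matrix.transpose_apply]
    rw [left, mul_assoc]
    congr 1
    rw [Finset.mul_sum]
    refine Finset.sum_congr rfl fun π _ => ?_
    rw [Matrix.mul_apply]
    simp only [mul_comm _ (alt n k _ T)]
    rw [right, mul_left_comm, Finset.mul_sum]
    simp only [mul_assoc]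
  have reindex : ∀ π : Equiv.Perm (Fin k), ∑ σ : Equiv.Perm (Fin k),
      ((Equiv.Perm.sign π : ℤ) : ℝ) * ((Equiv.Perm.sign σ : ℤ) : ℝ) *
        cartPow A k (s ∘ π) (t ∘ σ) =
      ∑ σ : Equiv.Perm (Fin k), ((Equiv.Perm.sign σ : ℤ) : ℝ) * cartPow A k s (t ∘ σ) := by
    intro π
    refine (Fintype.sum_equiv (Equiv.mulRight π) _ _ fun σ => ?_).symm
    have h : t ∘ (Equiv.mulRight π σ) = (t ∘ σ) ∘ π := rfl
    rw [h, cartPow_comp_perm]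
    congr 1
    rw [Equiv.coe_mulRight, Equiv.Perm.sign_mul, ← Int.cast_mul, ← Units.val_mul, mul_comm,
      mul_assoc, Int.units_mul_self, mul_one]
  rw [expand, Finset.sum_congr rfl fun π _ => reindex π, Finset.sum_const, Finset.card_univ,
    Fintype.card_perm, Fintype.card_fin, nsmul_eq_mul, ← mul_assoc, hcc, one_mul]

theorem prod_erase_ite_eq_one_or_zero {k : ℕ} {α : Type*} [DecidableEq α] (u v : Fin k → α)
    (i : Fin k) :
    (∏ j ∈ Finset.univ.erase i, (if u j = v j then (1 : ℝ) else 0)) =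
      if ∀ j, j ≠ i → u j = v j then 1 else 0 := by
  split_ifs with h
  · exact Finset.prod_eq_one fun j hj => if_pos (h j (Finset.ne_of_mem_erase hj))
  · push Not at h
    obtain ⟨j, hj, hne⟩ := h
    exact Finset.prod_eq_zero (Finset.mem_erase.2 ⟨hj, Finset.mem_univ _⟩) (if_neg hne)

theorem card_filter_lt_orderEmbOfFin {α : Type*} [LinearOrder α] {k : ℕ} (S : Finset α)
    (h : S.card = k) (p : Fin k) :
    (S.filter (· < S.orderEmbOfFin h p)).card = (p : ℕ) := by
  have : S.filter (· < S.orderEmbOfFin h p) =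
      (Finset.Iio p).map (S.orderEmbOfFin h).toEmbedding := by
    ext x
    simp only [Finset.mem_filter, Finset.mem_map, Finset.mem_Iio, RelEmbedding.coe_toEmbedding]
    constructor
    · rintro ⟨hx, hlt⟩
      have hx' : x ∈ Set.range (S.orderEmbOfFin h) := by
        rw [Finset.range_orderEmbOfFin]
        exact hx
      obtain ⟨j, rfl⟩ := hx'
      exact ⟨j, by simpa using hlt, rfl⟩
    · rintro ⟨j, hj, rfl⟩
      exact ⟨Finset.orderEmbOfFin_mem _ _ _, by simpa using hj⟩
  rw [this, Finset.card_map, Fin.card_Iio]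

/-- The numbers of elements of `R` below `a` and below `b` add up, modulo two, to the number of
elements of `R` strictly between `a` and `b`. -/
theorem neg_one_pow_card_filter_lt_mul {α : Type*} [LinearOrder α] (R : Finset α) {a b : α}
    (ha : a ∉ R) (hb : b ∉ R) :
    (-1 : ℝ) ^ (R.filter (· < b)).card * (-1 : ℝ) ^ (R.filter (· < a)).card =
      (-1 : ℝ) ^ (R.filter (fun x => min a b < x ∧ x < max a b)).card := by
  wlog hab : a ≤ b generalizing a b
  · rw [mul_comm, this hb ha (le_of_not_ge hab), min_comm, max_comm]
  have hsplit : (R.filter (· < b)).card = (R.filter (· < a)).card +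
      (R.filter (fun x => min a b < x ∧ x < max a b)).card := by
    rw [← Finset.card_union_of_disjoint]
    · congr 1
      ext x
      simp only [Finset.mem_filter, Finset.mem_union, min_eq_left hab, max_eq_right hab]
      constructor
      · rintro ⟨hx, hxb⟩
        rcases lt_trichotomy x a with h | h | h
        · exact Or.inl ⟨hx, h⟩
        · exact absurd (h ▸ hx) ha
        · exact Or.inr ⟨hx, h, hxb⟩
      · rintro (⟨hx, h⟩ | ⟨hx, -, h⟩)
        · exact ⟨hx, h.trans_le hab⟩
        · exact ⟨hx, h⟩
    · rw [Finset.disjoint_filter]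
      intro x _ hx h
      rw [min_eq_left hab] at h
      exact lt_asymm hx h.1
  rw [hsplit, pow_add, mul_right_comm, ← mul_pow]
  simp

/-- Removing the value at `p` from the increasing enumeration of `S` enumerates the remaining
elements increasingly. -/
theorem orderEmbOfFin_succAbove {α : Type*} [LinearOrder α] {l : ℕ} {S R : Finset α}
    (hS : S.card = l + 1) (hR : R.card = l) {p : Fin (l + 1)}
    (h : S.erase (S.orderEmbOfFin hS p) = R) (j : Fin l) :
    S.orderEmbOfFin hS (p.succAbove j) = R.orderEmbOfFin hR j := by
  have := Finset.orderEmbOfFin_unique hR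
    (f := fun j => S.orderEmbOfFin hS (p.succAbove j)) (fun j => by
      rw [← h, Finset.mem_erase]
      exact ⟨by simp, Finset.orderEmbOfFin_mem _ _ _⟩)
    ((S.orderEmbOfFin hS).strictMono.comp (Fin.strictMono_succAbove p))
  exact congrFun this j

theorem exists_orderEmbOfFin_eq {α : Type*} [LinearOrder α] {k : ℕ} {S : Finset α}
    (h : S.card = k) {x : α} (hx : x ∈ S) : ∃ p, S.orderEmbOfFin h p = x := by
  have hx' : x ∈ Set.range (S.orderEmbOfFin h) := by
    rw [Finset.range_orderEmbOfFin]
    exact hx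
  exact hx'

theorem extPow_eq_of_sdiff_eq_singleton {n k : ℕ} (A : Matrix (Fin n) (Fin n) ℝ)
    (S T : {S : Finset (Fin n) // S.card = k}) {a b : Fin n}
    (hab : S.1 \ T.1 = {a}) (hba : T.1 \ S.1 = {b}) :
    extPow A k S T =
      (-1 : ℝ) ^ ((S.1 ∩ T.1).filter (fun x => min a b < x ∧ x < max a b)).card * A a b := by
  rw [extPow_eq_sum_perm]
  obtain ⟨S, hS⟩ := S
  obtain ⟨T, hT⟩ := T
  dsimp only at hab hba ⊢
  obtain ⟨haS, haT⟩ : a ∈ S ∧ a ∉ T := Finset.mem_sdiff.1 (hab ▸ Finset.mem_singleton_self a)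
  obtain ⟨hbT, hbS⟩ : b ∈ T ∧ b ∉ S := Finset.mem_sdiff.1 (hba ▸ Finset.mem_singleton_self b)
  obtain ⟨l, rfl⟩ : ∃ l, k = l + 1 :=
    Nat.exists_eq_succ_of_ne_zero (by rw [← hS]; exact (Finset.card_pos.2 ⟨a, haS⟩).ne')
  have hSR : S.erase a = S ∩ T := by
    rw [Finset.erase_eq, ← hab, Finset.sdiff_sdiff_self_left]
  have hTR : T.erase b = S ∩ T := by
    rw [Finset.erase_eq, ← hba, Finset.sdiff_sdiff_self_left, Finset.inter_comm]
  have hR : (S ∩ T).card = l := by rw [← hSR, Finset.card_erase_of_mem haS, hS]; rfl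
  obtain ⟨p, hp⟩ := exists_orderEmbOfFin_eq hS haS
  obtain ⟨q, hq⟩ := exists_orderEmbOfFin_eq hT hbT
  have hs := orderEmbOfFin_succAbove hS hR (hp ▸ hSR)
  have ht := orderEmbOfFin_succAbove hT hR (hq ▸ hTR)
  have hpc : (p : ℕ) = ((S ∩ T).filter (· < a)).card := by
    rw [← card_filter_lt_orderEmbOfFin S hS p, hp, ← hSR, Finset.filter_erase,
      Finset.erase_eq_of_notMem (by simp)]
  have hqc : (q : ℕ) = ((S ∩ T).filter (· < b)).card := by
    rw [← card_filter_lt_orderEmbOfFin T hT q, hq, ← hTR, Finset.filter_erase,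
      Finset.erase_eq_of_notMem (by simp)]
  set τ : Equiv.Perm (Fin (l + 1)) := q.cycleRange⁻¹ * p.cycleRange with hτ
  have hτp : τ p = q := by
    simp [hτ, Equiv.Perm.inv_def]
  have hτs : ∀ j, τ (p.succAbove j) = q.succAbove j := fun j => by
    simp [hτ, Equiv.Perm.inv_def]
  have hsign : ((Equiv.Perm.sign τ : ℤ) : ℝ) =
      (-1 : ℝ) ^ ((S ∩ T).filter (fun x => min a b < x ∧ x < max a b)).card := by
    rw [← neg_one_pow_card_filter_lt_mul (S ∩ T) (a := a) (b := b) (by simp [haT]) (by simp [hbS]),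
      ← hpc, ← hqc, hτ, Equiv.Perm.sign_mul, Equiv.Perm.sign_inv, Fin.sign_cycleRange,
      Fin.sign_cycleRange]
    push_cast
    rfl
  have hcart : ∀ σ : Equiv.Perm (Fin (l + 1)),
      cartPow A (l + 1) (S.orderEmbOfFin hS) (T.orderEmbOfFin hT ∘ σ) =
        if σ = τ then A a b else 0 := by
    intro σ
    simp only [cartPow, Matrix.of_apply, prod_erase_ite_eq_one_or_zero, Function.comp_apply]
    rw [Finset.sum_eq_single p]
    · split_ifs with h₁ h₂ h₂
      · rw [h₂, hτp, hp, hq, mul_one]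
      · refine absurd (Equiv.ext fun j => ?_) h₂
        rcases Fin.eq_self_or_eq_succAbove p j with rfl | ⟨j, rfl⟩
        · rw [hτp]
          by_contra hne
          have hj : σ.symm q ≠ j := fun hj => hne (by rw [← hj, σ.apply_symm_apply])
          have := h₁ _ hj
          rw [σ.apply_symm_apply, hq] at this
          exact hbS (this ▸ Finset.orderEmbOfFin_mem _ _ _)
        · rw [hτs]
          have := h₁ _ (Fin.succAbove_ne p j)
          rw [hs, ← ht] at this
          exact ((T.orderEmbOfFin hT).injective this).symm
      · refine absurd (fun j hj => ?_) h₁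
        obtain ⟨j, rfl⟩ := Fin.exists_succAbove_eq hj
        rw [h₂, hτs, hs, ht]
      · rw [mul_zero]
    · intro i _ hi
      rw [if_neg, mul_zero]
      intro h
      have := h p hi.symm
      rw [hp] at this
      exact haT (this ▸ Finset.orderEmbOfFin_mem _ _ _)
    · simp
  simp only [hcart, mul_ite, mul_zero, Finset.sum_ite_eq', Finset.mem_univ, if_true, hsign]

/-- If all but at most one of the elements of `S` belong to `T`, where `S` and `T` have the same
cardinality, then either they are equal or they differ by an exchange. -/
theorem exists_sdiff_eq_singleton_of_erase_subset {α : Type*} [DecidableEq α] {S T : Finset α}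
    (hcard : S.card = T.card) {x : α} (h : S.erase x ⊆ T) (hne : S ≠ T) :
    ∃ a b, S \ T = {a} ∧ T \ S = {b} := by
  have h₁ : S \ T ⊆ {x} := by
    intro y hy
    rw [Finset.mem_sdiff] at hy
    by_contra hyx
    exact hy.2 (h (Finset.mem_erase.2 ⟨by simpa using hyx, hy.1⟩))
  have h₂ : (S \ T).Nonempty := by
    rw [Finset.sdiff_nonempty]
    exact fun hST => hne (Finset.eq_of_subset_of_card_le hST hcard.ge)
  have h₃ : (S \ T).card = 1 :=
    le_antisymm (by simpa using Finset.card_le_card h₁) (Finset.card_pos.2 h₂)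
  have h₄ : (T \ S).card = 1 := by rw [← Finset.card_sdiff_comm hcard, h₃]
  obtain ⟨a, ha⟩ := Finset.card_eq_one.1 h₃
  obtain ⟨b, hb⟩ := Finset.card_eq_one.1 h₄
  exact ⟨a, b, ha, hb⟩

theorem extPow_eq_zero_of_not_exchange {n k : ℕ} (A : Matrix (Fin n) (Fin n) ℝ)
    (hA : ∀ i, A i i = 0) (S T : {S : Finset (Fin n) // S.card = k})
    (hST : ¬ ∃ a b : Fin n, S.1 \ T.1 = {a} ∧ T.1 \ S.1 = {b}) : extPow A k S T = 0 := by
  rw [extPow_eq_sum_perm]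
  obtain ⟨S, hS⟩ := S
  obtain ⟨T, hT⟩ := T
  dsimp only at hST ⊢
  refine Finset.sum_eq_zero fun σ _ => mul_eq_zero_of_right _ ?_
  simp only [cartPow, Matrix.of_apply, prod_erase_ite_eq_one_or_zero, Function.comp_apply]
  refine Finset.sum_eq_zero fun i _ => ?_
  split_ifs with h
  · have hsub : S.erase (S.orderEmbOfFin hS i) ⊆ T := by
      intro x hx
      obtain ⟨hxi, hxS⟩ := Finset.mem_erase.1 hx
      obtain ⟨j, rfl⟩ := exists_orderEmbOfFin_eq hS hxS
      rw [h j (fun hj => hxi (by rw [hj]))]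
      exact Finset.orderEmbOfFin_mem _ _ _
    have heq : S = T := by
      by_contra hne
      exact hST (exists_sdiff_eq_singleton_of_erase_subset (hS.trans hT.symm) hsub hne)
    subst heq
    have hσ : σ i = i := by
      by_contra hne
      have := h (σ i) hne
      exact hne (σ.injective ((S.orderEmbOfFin hS).injective this)).symm
    rw [hσ, hA, zero_mul]
  · rw [mul_zero]

theorem stmt4 {n k : ℕ} (hk : 1 ≤ k) (hkn : k ≤ n - 1)
    (A : Matrix (Fin n) (Fin n) ℝ) (hA : IsSignedMatrix A)
    (S T : {S : Finset (Fin n) // S.card = k}) :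
    (∀ a b : Fin n, S.1 \ T.1 = {a} → T.1 \ S.1 = {b} →
      extPow A k S T =
        (-1 : ℝ) ^ ((S.1 ∩ T.1).filter (fun x => min a b < x ∧ x < max a b)).card
          * A a b) ∧
    ((¬ ∃ a b : Fin n, S.1 \ T.1 = {a} ∧ T.1 \ S.1 = {b}) → extPow A k S T = 0) := by
  exact ⟨fun a b hab hba => extPow_eq_of_sdiff_eq_singleton A S T hab hba,
    extPow_eq_zero_of_not_exchange A hA.2.1 S T⟩
end
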